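/- Let $T_{q_0} = \langle X_n, Q, \pi, \lambda \rangle$ be an initial, synchronous, one-way synchronizing invertible transducer equal to its core, with inverse $S_{q_0^{-1}} = \langle X_n, Q^{-1}, \pi', \lambda' \rangle$. Let $A = \langle X_n, Q^{-1}, \pi', q_0^{-1} \rangle$ be the automaton obtained from $S_{q_0^{-1}}$ by forgetting outputs. Then $V_n^{T_{q_0}} = V_{\sim_A}$, where $V_n^{T_{q_0}} = T_{q_0}^{-1} V_n T_{q_0}$. -/

import Mathlib

open Classical

noncomputable section

/-- `n`-ary Cantor space: infinite words over the alphabet `Fin n`. -/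
abbrev Cantor (n : ℕ) : Type := ℕ → Fin n

/-- The finite word `w` is a prefix of the infinite word `χ`. -/
def PrefixOf {n : ℕ} (w : List (Fin n)) (χ : Cantor n) : Prop :=
  ∀ (i : ℕ) (h : i < w.length), w.get ⟨i, h⟩ = χ i

/-- Concatenation of a finite word with an infinite word. -/
def appendInf {n : ℕ} (w : List (Fin n)) (χ : Cantor n) : Cantor n :=
  fun i => if h : i < w.length then w.get ⟨i, h⟩ else χ (i - w.length)

/-- The cone (basic clopen set) of infinite words having the finite word `w` as prefix. -/
def cone {n : ℕ} (w : List (Fin n)) : Set (Cantor n) :=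
  {χ | PrefixOf w χ}

/-- The length-`k` prefix of an infinite word, as a finite word. -/
def takeW {n : ℕ} (χ : Cantor n) (k : ℕ) : List (Fin n) :=
  List.ofFn (fun i : Fin k => χ i)

/-- A finite family of finite words forming a maximal antichain:
every infinite word has exactly one member of the family as a prefix. -/
def AntichainFam {n m : ℕ} (α : Fin m → List (Fin n)) : Prop :=
  ∀ χ : Cantor n, ∃! i : Fin m, PrefixOf (α i) χ

/-- The group structure on self-homeomorphisms of a topological space,
with `f * g` acting as `g` followed by `f`. -/
instance homeoGroup {X : Type*} [TopologicalSpace X] : Group (X ≃ₜ X) where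
  mul f g := g.trans f
  one := Homeomorph.refl X
  inv := Homeomorph.symm
  mul_assoc a b c := Homeomorph.ext fun _ => rfl
  one_mul a := Homeomorph.ext fun _ => rfl
  mul_one a := Homeomorph.ext fun _ => rfl
  inv_mul_cancel a := Homeomorph.ext fun x => a.symm_apply_apply x

/-- The Higman–Thompson group `Vₙ`, as the set of self-homeomorphisms of Cantor space
which act by exchanging finite prefixes along a pair of maximal antichains. -/
def Vn (n : ℕ) : Set (Cantor n ≃ₜ Cantor n) :=
  {g | ∃ (m : ℕ) (α β : Fin m → List (Fin n)), AntichainFam α ∧ AntichainFam β ∧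
      ∀ (i : Fin m) (χ : Cantor n), g (appendInf (α i) χ) = appendInf (β i) χ}

/-- Conjugation in the paper's right-action convention: `paperConj g v = g⁻¹ v g`,
i.e. the homeomorphism `x ↦ (x) g⁻¹ v g` (first apply `g⁻¹`, then `v`, then `g`). -/
def paperConj {n : ℕ} (g v : Cantor n ≃ₜ Cantor n) : Cantor n ≃ₜ Cantor n :=
  (g.symm.trans v).trans g

/-- `l` is the longest common prefix of the set `A` of infinite words. -/
def IsLCP {n : ℕ} (A : Set (Cantor n)) (l : List (Fin n)) : Prop :=
  (∀ ρ ∈ A, PrefixOf l ρ) ∧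
    ∀ l' : List (Fin n), (∀ ρ ∈ A, PrefixOf l' ρ) → l'.length ≤ l.length

/-- A (not necessarily finite-state) transducer over the alphabet `Fin n`. -/
structure Transducer (n : ℕ) where
  /-- the set of states -/
  Q : Type
  /-- the transition function -/
  tr : Fin n → Q → Q
  /-- the output (rewrite) function -/
  out : Fin n → Q → List (Fin n)

namespace Transducer

variable {n : ℕ}

/-- The transition function extended to finite words. -/
def transStar (T : Transducer n) : List (Fin n) → T.Q → T.Q
  | [], q => q
  | x :: w, q => T.transStar w (T.tr x q)

/-- The output function extended to finite words. -/
def outStar (T : Transducer n) : List (Fin n) → T.Q → List (Fin n)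
  | [], _ => []
  | x :: w, q => T.out x q ++ T.outStar w (T.tr x q)

/-- The initial transducer `T_q` induces the map `f` on Cantor space: the outputs along
ever longer prefixes of `χ` are ever longer prefixes of `f χ`. -/
def Induces (T : Transducer n) (q : T.Q) (f : Cantor n → Cantor n) : Prop :=
  ∀ (χ : Cantor n) (m : ℕ), ∃ k : ℕ,
    m ≤ (T.outStar (takeW χ k) q).length ∧ PrefixOf (T.outStar (takeW χ k) q) (f χ)

/-- The image of the state `q`: the image of Cantor space under the map induced by `T_q`. -/
def stateImage (T : Transducer n) (q : T.Q) : Set (Cantor n) :=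
  {y | ∃ (f : Cantor n → Cantor n) (χ : Cantor n), T.Induces q f ∧ f χ = y}

/-- `T` is synchronizing at level `k`: the state reached after reading any word of
length `k` does not depend on the starting state. -/
def SyncAtLevel (T : Transducer n) (k : ℕ) : Prop :=
  ∀ w : List (Fin n), w.length = k → ∀ q q' : T.Q, T.transStar w q = T.transStar w q'

/-- `T` is synchronizing if it is synchronizing at some level. -/
def Synchronizing (T : Transducer n) : Prop := ∃ k, T.SyncAtLevel k

/-- `T` (inducing the homeomorphism `h` at `q0`) is one-way synchronizing: `T` is
synchronizing, but the inverse homeomorphism is not induced by any finite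
synchronizing transducer (equivalently, the inverse transducer is not synchronizing). -/
def OneWaySync (T : Transducer n) (q0 : T.Q) (h : Cantor n ≃ₜ Cantor n) : Prop :=
  T.Induces q0 ⇑h ∧ T.Synchronizing ∧
    ¬ ∃ (S : Transducer n) (_ : Finite S.Q) (s0 : S.Q),
        S.Induces s0 ⇑h.symm ∧ S.Synchronizing

/-- `T` is equal to its core : every state is reached by reading a word of length `k`
from some state, for every synchronizing level `k`. -/
def EqualToCore (T : Transducer n) : Prop :=
  ∀ k : ℕ, T.SyncAtLevel k → ∀ q : T.Q, ∃ (w : List (Fin n)) (p : T.Q),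
    w.length = k ∧ T.transStar w p = q

/-- Every state of `T` is accessible from `q0`. -/
def Accessible (T : Transducer n) (q0 : T.Q) : Prop :=
  ∀ q : T.Q, ∃ w : List (Fin n), T.transStar w q0 = q

/-- The product transducer `T S` (first act by `T`, then by `S`). -/
def prod (T S : Transducer n) : Transducer n where
  Q := T.Q × S.Q
  tr := fun x p => (T.tr x p.1, S.transStar (T.out x p.1) p.2)
  out := fun x p => S.outStar (T.out x p.1) p.2

/-- `T` is partially invertible: every state induces an injective map on Cantor space
with clopen image. -/
def PartiallyInvertible (T : Transducer n) : Prop :=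
  ∀ q : T.Q, ∃ f : Cantor n → Cantor n,
    T.Induces q f ∧ Function.Injective f ∧ IsClopen (Set.range f)

/-- `T` has no states of incomplete response: for each state `q` and letter `i`, no word
strictly longer than `λ(i,q)` is a common prefix of the outputs on all of the cone `[i]`. -/
def NoIncompleteResponse (T : Transducer n) : Prop :=
  ∀ (q : T.Q) (i x : Fin n),
    ¬ ∀ χ : Cantor n, ∃ k : ℕ, (T.out i q ++ [x]) <+: T.outStar (i :: takeW χ k) q

/-- States `q` of `T` and `p` of `S` are `ω`-equivalent: they induce one and the same
map on Cantor space. -/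
def OmegaEq (T : Transducer n) (q : T.Q) (S : Transducer n) (p : S.Q) : Prop :=
  ∃ f : Cantor n → Cantor n, T.Induces q f ∧ S.Induces p f

/-- `T` is minimal: no states of incomplete response and no pair of distinct
`ω`-equivalent states. -/
def Minimal (T : Transducer n) : Prop :=
  T.NoIncompleteResponse ∧ ∀ q q' : T.Q, T.OmegaEq q T q' → q = q'

/-- The map on Cantor space induced by the state `q` (junk value if none exists). -/
def inducedMap (T : Transducer n) (q : T.Q) : Cantor n → Cantor n :=
  if h : ∃ f, T.Induces q f then h.choose else id

/-- `𝓛_q(α)`: the longest common prefix of the preimage of the cone `[α]` under `T_q`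
(junk value if it does not exist). -/
def lcp (T : Transducer n) (q : T.Q) (α : List (Fin n)) : List (Fin n) :=
  if h : ∃ l, IsLCP {ρ : Cantor n | T.inducedMap q ρ ∈ cone α} l then h.choose else []

/-- The inverse transducer of `T` given by the inversion algorithm, on the set of all
pairs `(w, q)`: reading `x` from `(w,q)` outputs `𝓛_q(wx)` and moves to
`(wx - λ(𝓛_q(wx), q), π(𝓛_q(wx), q))`. -/
def invT (T : Transducer n) : Transducer n where
  Q := List (Fin n) × T.Q
  tr := fun x p =>
    ((p.1 ++ [x]).drop (T.outStar (T.lcp p.2 (p.1 ++ [x])) p.2).length,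
      T.transStar (T.lcp p.2 (p.1 ++ [x])) p.2)
  out := fun x p => T.lcp p.2 (p.1 ++ [x])

/-- Restriction of a transducer to a set of states (transitions leaving the set are
replaced by junk loops; for transition-closed sets this is the honest restriction). -/
def restrictTo (T : Transducer n) (P : T.Q → Prop) : Transducer n where
  Q := {q : T.Q // P q}
  tr := fun x q => if h : P (T.tr x q.1) then ⟨T.tr x q.1, h⟩ else q
  out := fun x q => T.out x q.1

/-- The set of states reachable from `q0`. -/
def reach (T : Transducer n) (q0 : T.Q) : T.Q → Prop :=
  fun q => ∃ w : List (Fin n), T.transStar w q0 = q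

/-- The inverse transducer of the initial transducer `T_{q0}`, with state set the states
accessible from `(ε, q0)`. -/
def invAcc (T : Transducer n) (q0 : T.Q) : Transducer n :=
  (T.invT).restrictTo ((T.invT).reach ([], q0))

/-- A pair `(w,p)` is good if `[w] ⊆ im(T_p)` and `𝓛_p(w) = ε`. -/
def GoodPair (T : Transducer n) (p : List (Fin n) × T.Q) : Prop :=
  cone p.1 ⊆ T.stateImage p.2 ∧
    IsLCP {ρ : Cantor n | T.inducedMap p.2 ρ ∈ cone p.1} []

/-- The partial inverse `T'` of a partially invertible transducer `T`: the inverse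
transducer restricted to the good pairs `(w,p)` with `[w] ⊆ im(T_p)`, `𝓛_p(w) = ε`. -/
def partialInv (T : Transducer n) : Transducer n :=
  (T.invT).restrictTo T.GoodPair

/-- `h` is a completion of `T`: there are a maximal antichain `η` and an effective viable
combination `(ρ, p)` such that `h` maps `η_i χ` to `ρ_i (χ)T_{p_i}`. -/
def IsCompletion (T : Transducer n) (h : Cantor n ≃ₜ Cantor n) : Prop :=
  ∃ (l : ℕ) (η ρ : Fin l → List (Fin n)) (p : Fin l → T.Q)
      (f : Fin l → (Cantor n → Cantor n)),
    l % (n - 1) = 1 % (n - 1) ∧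
    AntichainFam η ∧
    (∀ i, T.Induces (p i) (f i)) ∧
    (⋃ i, appendInf (ρ i) '' Set.range (f i)) = Set.univ ∧
    (∀ i j, i ≠ j →
      Disjoint (appendInf (ρ i) '' Set.range (f i))
        (appendInf (ρ j) '' Set.range (f j))) ∧
    ∀ (i : Fin l) (χ : Cantor n), h (appendInf (η i) χ) = appendInf (ρ i) (f i χ)

/-- The group `𝓗(T)` generated by all completions of `T`. -/
def HGroup (T : Transducer n) : Subgroup (Cantor n ≃ₜ Cantor n) :=
  Subgroup.closure {h | T.IsCompletion h}

/-- The subgroup-generating equivalence relation induced by the automaton underlying a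
transducer `A` with start state `a0` (by Lemma 4.1, two words are related iff the states
they reach are identified by the collapsing procedure, i.e. iff the reached states
transition identically on all sufficiently long words). -/
def simA (A : Transducer n) (a0 : A.Q) (α β : List (Fin n)) : Prop :=
  ∃ i : ℕ, ∀ w : List (Fin n), w.length = i →
    A.transStar w (A.transStar α a0) = A.transStar w (A.transStar β a0)

/-- `if b then T else T'`. -/
def factor (T : Transducer n) (b : Bool) : Transducer n :=
  if b then T else T.partialInv

/-- The product of a nonempty list of factors, each equal to `T` or its partial
inverse `T'`; these products make up the set `Π(T)`. -/
def prodOf (T : Transducer n) : List Bool → Transducer n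
  | [] => T
  | [b] => T.factor b
  | b :: c :: rest => (T.factor b).prod (T.prodOf (c :: rest))

/-- `T` is contracting: every state of every product of copies of `T` and `T'` is
`ω`-equivalent to an initial transducer which, after reading some fixed length of input,
always acts as a state of `T`. -/
def Contracting (T : Transducer n) : Prop :=
  ∀ L : List Bool, L ≠ [] → ∀ q : (T.prodOf L).Q,
    ∃ (V : Transducer n) (p : V.Q) (f : Cantor n → Cantor n),
      (T.prodOf L).Induces q f ∧ V.Induces p f ∧
      ∃ j : ℕ, ∀ w : List (Fin n), w.length = j →
        ∃ (u : T.Q) (g : Cantor n → Cantor n),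
          V.Induces (V.transStar w p) g ∧ T.Induces u g

end Transducer

/-- The element `v` of `Vₙ` preserves the relation `r` on nonempty finite words:
whenever `v` replaces the prefix `α` by `β`, the words `α` and `β` are related. -/
def PreservesRel {n : ℕ} (r : List (Fin n) → List (Fin n) → Prop)
    (g : Cantor n ≃ₜ Cantor n) : Prop :=
  ∀ (α β : List (Fin n)), α ≠ [] → β ≠ [] →
    (∀ χ : Cantor n, g (appendInf α χ) = appendInf β χ) → r α β

/-- The subgroup `V_∼` of `Vₙ` generated by the prefix-exchange homeomorphisms
preserving the relation `r`. -/
def VSim (n : ℕ) (r : List (Fin n) → List (Fin n) → Prop) :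
    Subgroup (Cantor n ≃ₜ Cantor n) :=
  Subgroup.closure {g | g ∈ Vn n ∧ PreservesRel r g}

/-- `f` coincides with `g` on the cone `[α]` (conjugated into the cone) and is the
identity off the cone: the homeomorphism `[α]_g`. -/
def IsRestrTo {n : ℕ} (α : List (Fin n)) (g f : Cantor n ≃ₜ Cantor n) : Prop :=
  (∀ χ : Cantor n, f (appendInf α χ) = appendInf α (g χ)) ∧
  ∀ χ : Cantor n, ¬ PrefixOf α χ → f χ = χ

/-- The Nekrashevych group `Vₙ(G)`: the group generated by `Vₙ` together with all the
homeomorphisms `[α]_g` for `g ∈ G`. -/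
def NekG (n : ℕ) (G : Subgroup (Cantor n ≃ₜ Cantor n)) :
    Subgroup (Cantor n ≃ₜ Cantor n) :=
  Subgroup.closure (Vn n ∪ {f | ∃ (α : List (Fin n)) (g : Cantor n ≃ₜ Cantor n),
    g ∈ G ∧ IsRestrTo α g f})

/-- The homeomorphism `f` locally agrees with the set `G` of homeomorphisms. -/
def LocallyAgrees {n : ℕ} (G : Set (Cantor n ≃ₜ Cantor n))
    (f : Cantor n ≃ₜ Cantor n) : Prop :=
  ∀ x : Cantor n, ∃ U : Set (Cantor n), IsOpen U ∧ x ∈ U ∧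
    ∃ g ∈ G, Set.EqOn ⇑f ⇑g U

/-- A finite synchronous invertible transducer over `Fin n`: each state rewrites single
letters to single letters bijectively. -/
structure SyncTransducer (n : ℕ) where
  /-- the set of states -/
  Q : Type
  /-- there are finitely many states -/
  fin : Finite Q
  /-- the transition function -/
  tr : Fin n → Q → Q
  /-- the (single-letter) output function -/
  out : Fin n → Q → Fin n
  /-- each state rewrites letters bijectively -/
  bij : ∀ q : Q, Function.Bijective fun x => out x q

namespace SyncTransducer

variable {n : ℕ}

/-- The transition function extended to finite words. -/
def trStar (U : SyncTransducer n) : List (Fin n) → U.Q → U.Q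
  | [], q => q
  | x :: w, q => U.trStar w (U.tr x q)

/-- The output function extended to finite words. -/
def outWord (U : SyncTransducer n) : List (Fin n) → U.Q → List (Fin n)
  | [], _ => []
  | x :: w, q => U.out x q :: U.outWord w (U.tr x q)

/-- The map on Cantor space induced by the initial transducer `U_q`. -/
def applyFun (U : SyncTransducer n) (q : U.Q) (χ : Cantor n) : Cantor n :=
  fun i => U.out (χ i) (U.trStar (takeW χ i) q)

/-- The inverse transducer of a synchronous invertible transducer. -/
def inv (U : SyncTransducer n) : SyncTransducer n where
  Q := U.Q
  fin := U.fin
  tr := fun y q => U.tr ((Equiv.ofBijective _ (U.bij q)).symm y) q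
  out := fun y q => (Equiv.ofBijective _ (U.bij q)).symm y
  bij := fun q => (Equiv.ofBijective _ (U.bij q)).symm.bijective

/-- The product of synchronous transducers (first act by `T`, then by `S`). -/
def sprod (T S : SyncTransducer n) : SyncTransducer n where
  Q := T.Q × S.Q
  fin := by
    haveI := T.fin; haveI := S.fin
    infer_instance
  tr := fun x p => (T.tr x p.1, S.tr (T.out x p.1) p.2)
  out := fun x p => S.out (T.out x p.1) p.2
  bij := fun p => (S.bij p.2).comp (T.bij p.1)

/-- `U` is synchronizing at level `k`. -/
def SyncAtLevel (U : SyncTransducer n) (k : ℕ) : Prop :=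
  ∀ w : List (Fin n), w.length = k → ∀ q q' : U.Q, U.trStar w q = U.trStar w q'

/-- `U` is synchronizing. -/
def Synchronizing (U : SyncTransducer n) : Prop := ∃ k, U.SyncAtLevel k

/-- `U` is minimal (under `ω`-equivalence): distinct states induce distinct maps. -/
def Minimal (U : SyncTransducer n) : Prop :=
  ∀ q q' : U.Q, U.applyFun q = U.applyFun q' → q = q'

/-- One-way synchronizing: `U` is synchronizing but the inverse homeomorphism of
`h = U_{q0}` is not induced by any finite synchronizing transducer. -/
def OneWaySync (U : SyncTransducer n) (h : Cantor n ≃ₜ Cantor n) : Prop :=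
  U.Synchronizing ∧
    ¬ ∃ (S : Transducer n) (_ : Finite S.Q) (s0 : S.Q),
        S.Induces s0 ⇑h.symm ∧ S.Synchronizing

/-- `U` is equal to its core. -/
def EqualToCore (U : SyncTransducer n) : Prop :=
  ∀ k : ℕ, U.SyncAtLevel k → ∀ q : U.Q, ∃ (w : List (Fin n)) (p : U.Q),
    w.length = k ∧ U.trStar w p = q

/-- The underlying (asynchronous-format) transducer of a synchronous transducer. -/
def toT (U : SyncTransducer n) : Transducer n :=
  ⟨U.Q, U.tr, fun x q => [U.out x q]⟩

/-- The automaton group `𝒢(U)` generated by `U`: the subgroup of the homeomorphism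
group of Cantor space generated by the homeomorphisms `U_q` for the states `q`. -/
def autG (U : SyncTransducer n) : Subgroup (Cantor n ≃ₜ Cantor n) :=
  Subgroup.closure {f : Cantor n ≃ₜ Cantor n | ∃ q : U.Q, ⇑f = U.applyFun q}

end SyncTransducer

section Words

variable {n : ℕ}

theorem appendInf_nil (χ : Cantor n) : appendInf [] χ = χ := by
  funext i; simp [appendInf]

theorem appendInf_cons_zero (x : Fin n) (w : List (Fin n)) (χ : Cantor n) :
    appendInf (x :: w) χ 0 = x := by
  simp [appendInf]

theorem appendInf_cons_succ (x : Fin n) (w : List (Fin n)) (χ : Cantor n) (i : ℕ) :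
    appendInf (x :: w) χ (i + 1) = appendInf w χ i := by
  simp [appendInf]

theorem appendInf_append (u w : List (Fin n)) (χ : Cantor n) :
    appendInf (u ++ w) χ = appendInf u (appendInf w χ) := by
  induction u with
  | nil => simp [appendInf_nil]
  | cons x u ih =>
    funext i
    cases i with
    | zero => simp [appendInf_cons_zero]
    | succ i => simp [appendInf_cons_succ, ih]

theorem appendInf_apply_length_add (w : List (Fin n)) (χ : Cantor n) (i : ℕ) :
    appendInf w χ (w.length + i) = χ i := by
  simp [appendInf]

theorem appendInf_apply_of_lt (w : List (Fin n)) (χ : Cantor n) {i : ℕ} (hi : i < w.length) :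
    appendInf w χ i = w[i] := by
  simp [appendInf, hi]

theorem prefixOf_iff (w : List (Fin n)) (χ : Cantor n) :
    PrefixOf w χ ↔ ∃ ξ, χ = appendInf w ξ := by
  constructor
  · intro hp
    refine ⟨fun i => χ (w.length + i), funext fun i => ?_⟩
    by_cases hi : i < w.length
    · rw [appendInf_apply_of_lt _ _ hi]; exact (hp i hi).symm
    · obtain ⟨j, rfl⟩ := Nat.exists_eq_add_of_le (not_lt.mp hi)
      rw [appendInf_apply_length_add]
  · rintro ⟨ξ, rfl⟩ i hi
    rw [appendInf_apply_of_lt _ _ hi]; rfl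

theorem eq_of_appendInf_eq {u b : List (Fin n)} (hl : u.length = b.length) {χ ξ : Cantor n}
    (he : appendInf u χ = appendInf b ξ) : u = b ∧ χ = ξ := by
  constructor
  · refine List.ext_getElem hl fun i hi hi' => ?_
    rw [← appendInf_apply_of_lt u χ hi, ← appendInf_apply_of_lt b ξ hi', he]
  · funext i
    rw [← appendInf_apply_length_add u χ i, he, hl, appendInf_apply_length_add]

theorem length_le_of_appendInf_eq (hn : 2 ≤ n) {u b : List (Fin n)} {F G : Cantor n → Cantor n}
    (hF : Function.Surjective F) (he : ∀ χ, appendInf u (F χ) = appendInf b (G χ)) :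
    b.length ≤ u.length := by
  by_contra! hlt
  have hconst : ∀ χ, F χ 0 = b[u.length] := fun χ => by
    rw [← appendInf_apply_length_add u (F χ) 0, he χ]
    exact appendInf_apply_of_lt _ _ hlt
  have : Nontrivial (Fin n) := Fin.nontrivial_iff_two_le.mpr hn
  obtain ⟨y, hy⟩ := exists_ne (b[u.length])
  obtain ⟨χ, hχ⟩ := hF (fun _ => y)
  exact hy (by rw [← hconst χ, hχ])

theorem eq_of_forall_appendInf_eq (hn : 2 ≤ n) {u b : List (Fin n)} {F G : Cantor n → Cantor n}
    (hF : Function.Surjective F) (hG : Function.Surjective G)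
    (he : ∀ χ, appendInf u (F χ) = appendInf b (G χ)) : F = G :=
  funext fun χ => (eq_of_appendInf_eq (le_antisymm
    (length_le_of_appendInf_eq hn hG fun χ => (he χ).symm)
    (length_le_of_appendInf_eq hn hF he)) (he χ)).2

end Words

section HigmanThompson

variable {n : ℕ}

/-- `g` exchanges prefixes on every cone of depth at least `N`. -/
def ExchangesFrom (g : Cantor n ≃ₜ Cantor n) (N : ℕ) : Prop :=
  ∀ w : List (Fin n), N ≤ w.length → ∃ u : List (Fin n), ∀ χ, g (appendInf w χ) = appendInf u χ

theorem mem_Vn_iff (hn : 2 ≤ n) (g : Cantor n ≃ₜ Cantor n) :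
    g ∈ Vn n ↔ ∃ N, ExchangesFrom g N := by
  constructor
  · rintro ⟨m, α, β, hα, -, hg⟩
    obtain ⟨N, hN⟩ := Finite.exists_le fun i => (α i).length
    refine ⟨N, fun w hw => ?_⟩
    obtain ⟨i, hi, -⟩ := hα (appendInf w fun _ => ⟨0, by omega⟩)
    have hlen : (α i).length ≤ w.length := (hN i).trans hw
    have hpre : w = α i ++ w.drop (α i).length := by
      conv_lhs => rw [← List.take_append_drop (α i).length w]
      congr 1
      refine List.ext_getElem (by simpa using hlen) fun j hj hj' => ?_
      have := hi j hj'
      rw [appendInf_apply_of_lt _ _ (hj'.trans_le hlen)] at this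
      simpa using this.symm
    refine ⟨β i ++ w.drop (α i).length, fun χ => ?_⟩
    rw [hpre, appendInf_append, hg, appendInf_append, ← hpre]
  · rintro ⟨N, hN⟩
    have hu : ∀ φ : Fin N → Fin n, ∃ u : List (Fin n), ∀ χ,
        g (appendInf (List.ofFn φ) χ) = appendInf u χ := fun φ => hN _ (by simp)
    choose u hu using hu
    let e := (Fintype.equivFin (Fin N → Fin n)).symm
    have hα : AntichainFam fun i => List.ofFn (e i) := by
      have key : ∀ (φ : Fin N → Fin n) (χ : Cantor n),
          PrefixOf (List.ofFn φ) χ ↔ φ = fun i : Fin N => χ i := by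
        intro φ χ
        constructor
        · intro hp
          funext i
          simpa using hp i (by simp)
        · rintro rfl i hi
          simp
      intro χ
      refine ⟨e.symm fun i : Fin N => χ i, by simp [key], fun j hj => ?_⟩
      replace hj := (key _ _).1 hj
      rw [← hj, e.symm_apply_apply]
    have hiff : ∀ i χ, PrefixOf (u (e i)) χ ↔ PrefixOf (List.ofFn (e i)) (g.symm χ) := by
      intro i χ
      rw [prefixOf_iff, prefixOf_iff]
      refine exists_congr fun ξ => ?_
      rw [← hu, Homeomorph.symm_apply_eq]
    refine ⟨_, fun i => List.ofFn (e i), fun i => u (e i), hα, fun χ => ?_, fun i => hu (e i)⟩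
    simp only [hiff]
    exact hα (g.symm χ)

/-- The Higman–Thompson group as a subgroup of the homeomorphism group of Cantor space. -/
def VnSubgroup (hn : 2 ≤ n) : Subgroup (Cantor n ≃ₜ Cantor n) where
  carrier := Vn n
  one_mem' := (mem_Vn_iff hn _).2 ⟨0, fun w _ => ⟨w, fun _ => rfl⟩⟩
  mul_mem' {f g} hf hg := by
    rw [mem_Vn_iff hn] at hf hg ⊢
    obtain ⟨N, hN⟩ := hf
    obtain ⟨M, hM⟩ := hg
    refine ⟨M + N, fun w hw => ?_⟩
    obtain ⟨u, hu⟩ := hM (w.take M) (by simp; omega)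
    obtain ⟨t, ht⟩ := hN (u ++ w.drop M) (by simp; omega)
    refine ⟨t, fun χ => ?_⟩
    change f (g _) = _
    rw [← ht, ← List.take_append_drop M w, appendInf_append, hu]
    simp [appendInf_append]
  inv_mem' {g} hg := by
    obtain ⟨m, α, β, hα, hβ, hg⟩ := hg
    exact ⟨m, β, α, hβ, hα, fun i χ => (Homeomorph.symm_apply_eq g).2 (hg i χ).symm⟩

/-- Conjugation in the right-action convention, as a homomorphism. -/
def paperConjHom (h : Cantor n ≃ₜ Cantor n) : (Cantor n ≃ₜ Cantor n) →* (Cantor n ≃ₜ Cantor n) where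
  toFun := paperConj h
  map_one' := Homeomorph.ext fun χ => h.apply_symm_apply χ
  map_mul' f g := Homeomorph.ext fun χ => by
    change h (f (g (h.symm χ))) = h (f (h.symm (h (g (h.symm χ)))))
    rw [h.symm_apply_apply]

end HigmanThompson

namespace SyncTransducer

variable {n : ℕ} (U : SyncTransducer n)

theorem trStar_append (u w : List (Fin n)) (q : U.Q) :
    U.trStar (u ++ w) q = U.trStar w (U.trStar u q) := by
  induction u generalizing q with
  | nil => rfl
  | cons x u ih => exact ih _

theorem length_outWord (w : List (Fin n)) (q : U.Q) : (U.outWord w q).length = w.length := by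
  induction w generalizing q with
  | nil => rfl
  | cons x w ih => simp [outWord, ih]

theorem applyFun_zero (q : U.Q) (χ : Cantor n) : U.applyFun q χ 0 = U.out (χ 0) q := by
  simp [applyFun, takeW, trStar]

theorem applyFun_succ (q : U.Q) (χ : Cantor n) (i : ℕ) :
    U.applyFun q χ (i + 1) = U.applyFun (U.tr (χ 0) q) (fun j => χ (j + 1)) i := by
  simp [applyFun, takeW, trStar, List.ofFn_succ]

theorem applyFun_appendInf (w : List (Fin n)) (q : U.Q) (χ : Cantor n) :
    U.applyFun q (appendInf w χ) = appendInf (U.outWord w q) (U.applyFun (U.trStar w q) χ) := by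
  induction w generalizing q with
  | nil => simp [appendInf_nil, outWord, trStar]
  | cons x w ih =>
    funext i
    cases i with
    | zero => simp [applyFun_zero, appendInf_cons_zero, outWord]
    | succ i =>
      simp only [applyFun_succ, appendInf_cons_zero, appendInf_cons_succ, outWord, trStar]
      exact congrFun (ih _) i

/-- The transition function of the inverse transducer on finite words, on the states of `U`. -/
def invTrStar (w : List (Fin n)) (q : U.Q) : U.Q := U.inv.trStar w q

/-- The output function of the inverse transducer on finite words, on the states of `U`. -/
def invOutWord (w : List (Fin n)) (q : U.Q) : List (Fin n) := U.inv.outWord w q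

/-- The map induced by the inverse transducer, on the states of `U`. -/
def invApplyFun (q : U.Q) (χ : Cantor n) : Cantor n := U.inv.applyFun q χ

/-- The letter that the state `q` rewrites to `x`. -/
def invOut (x : Fin n) (q : U.Q) : Fin n := (Equiv.ofBijective _ (U.bij q)).symm x

theorem out_invOut (x : Fin n) (q : U.Q) : U.out (U.invOut x q) q = x :=
  (Equiv.ofBijective _ (U.bij q)).apply_symm_apply x

theorem invOut_out (x : Fin n) (q : U.Q) : U.invOut (U.out x q) q = x :=
  (Equiv.ofBijective _ (U.bij q)).symm_apply_apply x

theorem invTrStar_cons (x : Fin n) (w : List (Fin n)) (q : U.Q) :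
    U.invTrStar (x :: w) q = U.invTrStar w (U.tr (U.invOut x q) q) := rfl

theorem invOutWord_cons (x : Fin n) (w : List (Fin n)) (q : U.Q) :
    U.invOutWord (x :: w) q = U.invOut x q :: U.invOutWord w (U.tr (U.invOut x q) q) := rfl

theorem invTrStar_append (u w : List (Fin n)) (q : U.Q) :
    U.invTrStar (u ++ w) q = U.invTrStar w (U.invTrStar u q) :=
  U.inv.trStar_append u w q

theorem length_invOutWord (w : List (Fin n)) (q : U.Q) : (U.invOutWord w q).length = w.length :=
  U.inv.length_outWord w q

theorem invApplyFun_zero (q : U.Q) (χ : Cantor n) : U.invApplyFun q χ 0 = U.invOut (χ 0) q :=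
  U.inv.applyFun_zero q χ

theorem invApplyFun_succ (q : U.Q) (χ : Cantor n) (i : ℕ) :
    U.invApplyFun q χ (i + 1) =
      U.invApplyFun (U.tr (U.invOut (χ 0) q) q) (fun j => χ (j + 1)) i :=
  U.inv.applyFun_succ q χ i

theorem invApplyFun_appendInf (w : List (Fin n)) (q : U.Q) (χ : Cantor n) :
    U.invApplyFun q (appendInf w χ) =
      appendInf (U.invOutWord w q) (U.invApplyFun (U.invTrStar w q) χ) :=
  U.inv.applyFun_appendInf w q χ

theorem applyFun_invApplyFun (q : U.Q) (χ : Cantor n) :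
    U.applyFun q (U.invApplyFun q χ) = χ := by
  funext i
  induction i generalizing q χ with
  | zero => rw [applyFun_zero, invApplyFun_zero, out_invOut]
  | succ i ih =>
    simp only [applyFun_succ, invApplyFun_zero, invApplyFun_succ]
    exact ih _ _

theorem invApplyFun_applyFun (q : U.Q) (χ : Cantor n) :
    U.invApplyFun q (U.applyFun q χ) = χ := by
  funext i
  induction i generalizing q χ with
  | zero => rw [invApplyFun_zero, applyFun_zero, invOut_out]
  | succ i ih =>
    simp only [applyFun_succ, applyFun_zero, invApplyFun_succ, invOut_out]
    exact ih _ _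

theorem invTrStar_eq (w : List (Fin n)) (q : U.Q) :
    U.invTrStar w q = U.trStar (U.invOutWord w q) q := by
  induction w generalizing q with
  | nil => rfl
  | cons x w ih => exact ih _

theorem invTrStar_outWord (w : List (Fin n)) (q : U.Q) :
    U.invTrStar (U.outWord w q) q = U.trStar w q := by
  induction w generalizing q with
  | nil => rfl
  | cons x w ih =>
    rw [outWord, trStar, invTrStar_cons, invOut_out]
    exact ih _

theorem toT_transStar (w : List (Fin n)) (q : U.Q) : U.toT.transStar w q = U.trStar w q := by
  induction w generalizing q with
  | nil => rfl
  | cons x w ih => exact ih _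

theorem simA_inv_iff (q0 : U.Q) (α β : List (Fin n)) :
    U.inv.toT.simA q0 α β ↔ ∃ i, ∀ w : List (Fin n), w.length = i →
      U.invTrStar w (U.invTrStar α q0) = U.invTrStar w (U.invTrStar β q0) := by
  have key : ∀ w (q : U.Q), U.inv.toT.transStar w q = U.invTrStar w q := U.inv.toT_transStar
  refine exists_congr fun i => forall₂_congr fun w _ => ?_
  rw [← key, ← key α, ← key w, ← key β]
  exact Iff.rfl

variable {U} {q0 : U.Q} {h : Cantor n ≃ₜ Cantor n}

theorem symm_apply_eq_invApplyFun (hh : ⇑h = U.applyFun q0) (χ : Cantor n) :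
    h.symm χ = U.invApplyFun q0 χ := by
  rw [Homeomorph.symm_apply_eq, hh, applyFun_invApplyFun]

theorem paperConj_exchangesFrom (hh : ⇑h = U.applyFun q0) {k N : ℕ} (hk : U.SyncAtLevel k)
    {v : Cantor n ≃ₜ Cantor n} (hv : ExchangesFrom v N) :
    ExchangesFrom (paperConj h v) (N + k) := by
  intro w hw
  set a := (U.invOutWord w q0).take (w.length - k) with ha
  set c := (U.invOutWord w q0).drop (w.length - k) with hc
  have hac : U.invOutWord w q0 = a ++ c := (List.take_append_drop _ _).symm
  have hcl : c.length = k := by simp [hc, length_invOutWord]; omega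
  obtain ⟨u, hu⟩ := hv a (by simp [ha, length_invOutWord]; omega)
  refine ⟨U.outWord (u ++ c) q0, fun χ => ?_⟩
  change h (v (h.symm _)) = _
  have hst : U.trStar (u ++ c) q0 = U.invTrStar w q0 := by
    rw [invTrStar_eq, hac, trStar_append, trStar_append]
    exact hk c hcl _ _
  rw [symm_apply_eq_invApplyFun hh, invApplyFun_appendInf, hac, appendInf_append, hu,
    ← appendInf_append, hh, applyFun_appendInf, hst, applyFun_invApplyFun]

theorem paperConj_preservesRel (hn : 2 ≤ n) (hh : ⇑h = U.applyFun q0) {k N : ℕ}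
    (hk : U.SyncAtLevel k) {v : Cantor n ≃ₜ Cantor n} (hv : ExchangesFrom v N) :
    PreservesRel (U.inv.toT.simA q0) (paperConj h v) := by
  intro α β _ _ hαβ
  rw [simA_inv_iff]
  refine ⟨N + k, fun w hw => ?_⟩
  have hsurj : ∀ q, Function.Surjective (U.invApplyFun q) := fun q χ =>
    ⟨U.applyFun q χ, U.invApplyFun_applyFun q χ⟩
  rw [← List.take_append_drop N w, invTrStar_append, invTrStar_append, ← invTrStar_append _ α,
    ← invTrStar_append _ β]
  set a := α ++ w.take N with ha
  set b := β ++ w.take N with hb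
  have hcl : (w.drop N).length = k := by simp; omega
  obtain ⟨u, hu⟩ := hv (U.invOutWord a q0) (by simp [length_invOutWord, ha]; omega)
  have he : ∀ χ, appendInf u (U.invApplyFun (U.invTrStar a q0) χ) =
      appendInf (U.invOutWord b q0) (U.invApplyFun (U.invTrStar b q0) χ) := by
    intro χ
    rw [← hu, ← invApplyFun_appendInf, ← invApplyFun_appendInf, ← symm_apply_eq_invApplyFun hh,
      ← symm_apply_eq_invApplyFun hh, ← Homeomorph.symm_apply_eq h.symm, hb,
      appendInf_append β, ← hαβ, ha, appendInf_append α]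
    rfl
  have hFG := eq_of_forall_appendInf_eq hn (hsurj _) (hsurj _) he
  have hout : U.invOutWord (w.drop N) (U.invTrStar a q0) =
      U.invOutWord (w.drop N) (U.invTrStar b q0) := by
    have hχ := congrFun hFG (appendInf (w.drop N) fun _ => ⟨0, by omega⟩)
    rw [invApplyFun_appendInf, invApplyFun_appendInf] at hχ
    exact (eq_of_appendInf_eq (by simp [length_invOutWord]) hχ).1
  rw [invTrStar_eq, invTrStar_eq _ (w.drop N) (U.invTrStar b q0), hout]
  exact hk _ (by rw [length_invOutWord, hcl]) _ _

theorem exists_uniform_merge_bound : ∃ I : ℕ, ∀ p q : U.Q,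
    (∃ i, ∀ w : List (Fin n), w.length = i → U.trStar w p = U.trStar w q) →
      ∀ w : List (Fin n), I ≤ w.length → U.trStar w p = U.trStar w q := by
  have := U.fin
  have hi : ∀ pq : U.Q × U.Q, ∃ i,
      (∃ i, ∀ w : List (Fin n), w.length = i → U.trStar w pq.1 = U.trStar w pq.2) →
        ∀ w : List (Fin n), w.length = i → U.trStar w pq.1 = U.trStar w pq.2 := by
    intro pq
    by_cases hpq : ∃ i, ∀ w : List (Fin n), w.length = i → U.trStar w pq.1 = U.trStar w pq.2
    · exact hpq.imp fun i hi _ => hi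
    · exact ⟨0, fun hpq' => absurd hpq' hpq⟩
  choose i hi using hi
  obtain ⟨I, hI⟩ := Finite.exists_le i
  refine ⟨I, fun p q hpq w hw => ?_⟩
  have hle := hI (p, q)
  rw [← List.take_append_drop (i (p, q)) w, trStar_append, trStar_append,
    hi (p, q) hpq (w.take _) (by simp; omega)]

theorem exists_exchangesFrom_paperConj_symm (hh : ⇑h = U.applyFun q0) {N : ℕ}
    {g : Cantor n ≃ₜ Cantor n} (hg : ExchangesFrom g N)
    (hpres : PreservesRel (U.inv.toT.simA q0) g) :
    ∃ M, ExchangesFrom (paperConj h.symm g) M := by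
  obtain ⟨I, hI⟩ : ∃ I : ℕ, ∀ p q : U.Q,
      (∃ i, ∀ w : List (Fin n), w.length = i → U.invTrStar w p = U.invTrStar w q) →
        ∀ w : List (Fin n), I ≤ w.length → U.invTrStar w p = U.invTrStar w q :=
    U.inv.exists_uniform_merge_bound
  refine ⟨N + 1 + I, fun w hw => ?_⟩
  set a := (U.outWord w q0).take N with ha
  obtain ⟨x, c, hxc⟩ : ∃ x c, (U.outWord w q0).drop N = x :: c :=
    List.exists_cons_of_length_pos (by simp [length_outWord]; omega)
  have hac : U.outWord w q0 = (a ++ [x]) ++ c := by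
    rw [List.append_assoc, List.singleton_append, ← hxc, ha, List.take_append_drop]
  have hal : a.length = N := by simp [ha, length_outWord]; omega
  have hcl : I ≤ c.length := by
    have := congrArg List.length hac
    simp [length_outWord, hal] at this
    omega
  obtain ⟨u, hu⟩ := hg a hal.ge
  have hux : ∀ χ, g (appendInf (a ++ [x]) χ) = appendInf (u ++ [x]) χ := fun χ => by
    rw [appendInf_append, hu, ← appendInf_append]
  have hst : U.invTrStar (u ++ [x] ++ c) q0 = U.trStar w q0 := by
    rw [← invTrStar_outWord, hac, invTrStar_append, invTrStar_append _ (a ++ [x])]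
    refine (hI _ _ ?_ c hcl).symm
    exact (U.simA_inv_iff q0 _ _).1 (hpres (a ++ [x]) (u ++ [x]) (by simp) (by simp) hux)
  refine ⟨U.invOutWord (u ++ [x] ++ c) q0, fun χ => ?_⟩
  change h.symm (g (h _)) = _
  rw [hh, applyFun_appendInf, hac, appendInf_append, hux, ← appendInf_append,
    symm_apply_eq_invApplyFun hh, invApplyFun_appendInf, hst, invApplyFun_applyFun]

end SyncTransducer

/-- Theorem 4.2. Let `U_{q0}` be an initial, synchronous, one-way
synchronizing invertible transducer equal to its core, with inverse `S = U.inv`, and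
let `A` be the automaton obtained from `S_{q0⁻¹}` by forgetting outputs.  Then
`Vₙ^{U_{q0}} = V_{∼_A}`, where `Vₙ^{U_{q0}} = U_{q0}⁻¹ Vₙ U_{q0}`. -/
theorem conjugate_subgroup_eq_VsimA_synchronous
    {n : ℕ} (hn : 2 ≤ n) (U : SyncTransducer n) (q0 : U.Q)
    (h : Cantor n ≃ₜ Cantor n) (hh : ⇑h = U.applyFun q0)
    (hOne : U.OneWaySync h) (hCore : U.EqualToCore) :
    paperConj h '' Vn n = ↑(VSim n ((U.inv.toT).simA q0)) := by
  obtain ⟨⟨k, hk⟩, -⟩ := hOne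
  apply Set.Subset.antisymm
  · rintro _ ⟨v, hv, rfl⟩
    obtain ⟨N, hN⟩ := (mem_Vn_iff hn v).1 hv
    exact Subgroup.subset_closure
      ⟨(mem_Vn_iff hn _).2 ⟨_, SyncTransducer.paperConj_exchangesFrom hh hk hN⟩,
        SyncTransducer.paperConj_preservesRel hn hh hk hN⟩
  · suffices hle : VSim n (U.inv.toT.simA q0) ≤ (VnSubgroup hn).map (paperConjHom h) from hle
    refine (Subgroup.closure_le _).2 ?_
    rintro g ⟨hg, hpres⟩
    obtain ⟨N, hN⟩ := (mem_Vn_iff hn g).1 hg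
    refine ⟨paperConj h.symm g, (mem_Vn_iff hn _).2
      (SyncTransducer.exists_exchangesFrom_paperConj_symm hh hN hpres), ?_⟩
    refine Homeomorph.ext fun χ => ?_
    change h (h.symm (g (h (h.symm χ)))) = g χ
    rw [h.apply_symm_apply, h.apply_symm_apply]
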